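/- arXiv:1311.5115 — 8 statements merged into one kernel-verified Lean document; each statement's English description precedes it below -/
import Mathlib

section
/- Fix γ : Fin n → ℂ, a branch index k, and a bus index i. Then the function t ↦ (Y_bus(Function.update τ k t, θ)·γ)_i has derivative at τ_k equal to (-1/τ_k)·( 2·Y_ff,k·(C_f)_{k,i}·(C_f·γ)_k + Y_ft,k·(C_f)_{k,i}·(C_t·γ)_k + Y_tf,k·(C_t)_{k,i}·(C_f·γ)_k ), where Y_ff, Y_ft, Y_tf are evaluated at (τ,θ). That is, (Y_bus·γ)_τ = C_fᵀ[C_f γ][-2Y_ff][τ]⁻¹ + C_fᵀ[C_t γ][-Y_ft][τ]⁻¹ + C_tᵀ[C_f γ][-Y_tf][τ]⁻¹. -/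
open Matrix

noncomputable section

/-- A real matrix viewed as a complex matrix via coercion. -/
def cmat {m n : ℕ} (A : Matrix (Fin m) (Fin n) ℝ) : Matrix (Fin m) (Fin n) ℂ :=
  A.map Complex.ofReal

/-- Y_ff,l(τ,θ) = (y_s,l + i·b_c,l/2)/τ_l². -/
def Yff {m : ℕ} (ys : Fin m → ℂ) (bc : Fin m → ℝ) (τ : Fin m → ℝ) (l : Fin m) : ℂ :=
  (ys l + Complex.I * (bc l : ℂ) / 2) / (τ l : ℂ) ^ 2

/-- Y_ft,l(τ,θ) = -y_s,l·e^{iθ_l}/τ_l. -/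
def Yft {m : ℕ} (ys : Fin m → ℂ) (τ θ : Fin m → ℝ) (l : Fin m) : ℂ :=
  -ys l * Complex.exp (Complex.I * (θ l : ℂ)) / (τ l : ℂ)

/-- Y_tf,l(τ,θ) = -y_s,l·e^{-iθ_l}/τ_l. -/
def Ytf {m : ℕ} (ys : Fin m → ℂ) (τ θ : Fin m → ℝ) (l : Fin m) : ℂ :=
  -ys l * Complex.exp (-(Complex.I * (θ l : ℂ))) / (τ l : ℂ)

/-- Y_tt,l = y_s,l + i·b_c,l/2. -/
def Ytt {m : ℕ} (ys : Fin m → ℂ) (bc : Fin m → ℝ) (l : Fin m) : ℂ :=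
  ys l + Complex.I * (bc l : ℂ) / 2

/-- The bus admittance matrix
Y_bus = C_fᵀ[Y_ff]C_f + C_fᵀ[Y_ft]C_t + C_tᵀ[Y_tf]C_f + C_tᵀ[Y_tt]C_t + [Y_sh]. -/
def Ybus {m n : ℕ} (Cf Ct : Matrix (Fin m) (Fin n) ℝ) (ys : Fin m → ℂ) (bc : Fin m → ℝ)
    (Ysh : Fin n → ℂ) (τ θ : Fin m → ℝ) : Matrix (Fin n) (Fin n) ℂ :=
  (cmat Cf)ᵀ * diagonal (Yff ys bc τ) * cmat Cf
    + (cmat Cf)ᵀ * diagonal (Yft ys τ θ) * cmat Ct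
    + (cmat Ct)ᵀ * diagonal (Ytf ys τ θ) * cmat Cf
    + (cmat Ct)ᵀ * diagonal (Ytt ys bc) * cmat Ct
    + diagonal Ysh

/-- The bus power injection vector S_bus = [V](Y_bus V)*. -/
def Sbus {m n : ℕ} (Cf Ct : Matrix (Fin m) (Fin n) ℝ) (ys : Fin m → ℂ) (bc : Fin m → ℝ)
    (Ysh : Fin n → ℂ) (V : Fin n → ℂ) (τ θ : Fin m → ℝ) (i : Fin n) : ℂ :=
  V i * (starRingEnd ℂ) ((Ybus Cf Ct ys bc Ysh τ θ).mulVec V i)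

theorem transpose_mul_diagonal_mul_mulVec {m n : ℕ} (A B : Matrix (Fin m) (Fin n) ℂ)
    (d : Fin m → ℂ) (γ : Fin n → ℂ) (i : Fin n) :
    (Aᵀ * diagonal d * B).mulVec γ i = ∑ l, A l i * d l * B.mulVec γ l := by
  rw [← mulVec_mulVec]
  simp [mulVec, dotProduct, mul_diagonal]

/-- If only the `k`-th diagonal entry varies, the derivative of `Aᵀ [d t] B γ` is the
contribution of row `k`. -/
theorem hasDerivAt_transpose_mul_diagonal_mul_mulVec {m n : ℕ}
    (A B : Matrix (Fin m) (Fin n) ℂ) (γ : Fin n → ℂ) (i : Fin n) (k : Fin m)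
    {d : ℝ → Fin m → ℂ} {d' : ℂ} {x : ℝ} (hk : HasDerivAt (fun t => d t k) d' x)
    (hd : ∀ t, ∀ l ≠ k, d t l = d x l) :
    HasDerivAt (fun t => (Aᵀ * diagonal (d t) * B).mulVec γ i)
      (A k i * d' * B.mulVec γ k) x := by
  simp only [transpose_mul_diagonal_mul_mulVec]
  have h : ∀ l ∈ Finset.univ, HasDerivAt (fun t => A l i * d t l * B.mulVec γ l)
      (if l = k then A k i * d' * B.mulVec γ k else 0) x := by
    intro l _
    split_ifs with hl
    · subst hl
      exact (hk.const_mul _).mul_const _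
    · simp only [hd _ l hl]
      exact hasDerivAt_const _ _
  simpa using HasDerivAt.fun_sum h

theorem hasDerivAt_const_div_ofReal (c : ℂ) {x : ℝ} (hx : x ≠ 0) :
    HasDerivAt (fun t : ℝ => c / (t : ℂ)) (-1 / (x : ℂ) * (c / x)) x := by
  have hx' : (x : ℂ) ≠ 0 := Complex.ofReal_ne_zero.mpr hx
  refine ((hasDerivAt_const x c).fun_div (hasDerivAt_id x).ofReal_comp hx').congr_deriv ?_
  simp
  field_simp

theorem hasDerivAt_const_div_ofReal_sq (c : ℂ) {x : ℝ} (hx : x ≠ 0) :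
    HasDerivAt (fun t : ℝ => c / (t : ℂ) ^ 2) (-1 / (x : ℂ) * (2 * (c / x ^ 2))) x := by
  have hx' : (x : ℂ) ≠ 0 := Complex.ofReal_ne_zero.mpr hx
  refine ((hasDerivAt_const x c).fun_div ((hasDerivAt_id x).ofReal_comp.fun_pow 2)
    (pow_ne_zero 2 hx')).congr_deriv ?_
  simp
  field_simp

/-- (Y_bus·γ)_τ = C_fᵀ[C_f γ][-2Y_ff][τ]⁻¹ + C_fᵀ[C_t γ][-Y_ft][τ]⁻¹ + C_tᵀ[C_f γ][-Y_tf][τ]⁻¹,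
stated entrywise at bus `i` for the partial derivative in the tap magnitude `τ_k`. -/
theorem Ybus_mulVec_hasDerivAt_tau {m n : ℕ}
    (Cf Ct : Matrix (Fin m) (Fin n) ℝ) (ys : Fin m → ℂ) (bc : Fin m → ℝ)
    (Ysh : Fin n → ℂ) (τ θ : Fin m → ℝ) (hτ : ∀ l, τ l ≠ 0)
    (γ : Fin n → ℂ) (k : Fin m) (i : Fin n) :
    HasDerivAt
      (fun t : ℝ => (Ybus Cf Ct ys bc Ysh (Function.update τ k t) θ).mulVec γ i)
      ((-1 / (τ k : ℂ)) *
        (2 * Yff ys bc τ k * (Cf k i : ℂ) * (cmat Cf).mulVec γ k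
          + Yft ys τ θ k * (Cf k i : ℂ) * (cmat Ct).mulVec γ k
          + Ytf ys τ θ k * (Ct k i : ℂ) * (cmat Cf).mulVec γ k))
      (τ k) := by
  have hff := hasDerivAt_transpose_mul_diagonal_mul_mulVec (cmat Cf) (cmat Cf) γ i k
    (d := fun t => Yff ys bc (Function.update τ k t))
    (by simpa only [Yff, Function.update_self] using hasDerivAt_const_div_ofReal_sq _ (hτ k))
    (fun t l hl => by simp [Yff, hl])
  have hft := hasDerivAt_transpose_mul_diagonal_mul_mulVec (cmat Cf) (cmat Ct) γ i k
    (d := fun t => Yft ys (Function.update τ k t) θ)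
    (by simpa only [Yft, Function.update_self] using hasDerivAt_const_div_ofReal _ (hτ k))
    (fun t l hl => by simp [Yft, hl])
  have htf := hasDerivAt_transpose_mul_diagonal_mul_mulVec (cmat Ct) (cmat Cf) γ i k
    (d := fun t => Ytf ys (Function.update τ k t) θ)
    (by simpa only [Ytf, Function.update_self] using hasDerivAt_const_div_ofReal _ (hτ k))
    (fun t l hl => by simp [Ytf, hl])
  simp only [Ybus, add_mulVec, Pi.add_apply]
  refine ((((hff.fun_add hft).fun_add htf).add_const
    (((cmat Ct)ᵀ * diagonal (Ytt ys bc) * cmat Ct).mulVec γ i)).add_const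
    ((diagonal Ysh).mulVec γ i)).congr_deriv ?_
  simp only [Yff, Yft, Ytf, cmat, map_apply]
  ring
end
end

section
/- Fix bus voltages V : Fin n → ℂ and branch indices l, k. Then the function t ↦ I_f(Function.update τ k t, θ)_l has derivative at τ_k equal to 0 if l ≠ k, and for l = k equal to (-1/τ_k)·( 2·Y_ff,k·(C_f·V)_k + Y_ft,k·(C_t·V)_k ). That is, ∂I_f/∂τ = [C_f V][-2Y_ff][τ]⁻¹ + [C_t V][-Y_ft][τ]⁻¹. -/
open Matrix

noncomputable section

/-- The from-end branch current vector I_f = [Y_ff]C_f V + [Y_ft]C_t V. -/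
def If {m n : ℕ} (Cf Ct : Matrix (Fin m) (Fin n) ℝ) (ys : Fin m → ℂ) (bc : Fin m → ℝ)
    (V : Fin n → ℂ) (τ θ : Fin m → ℝ) (l : Fin m) : ℂ :=
  Yff ys bc τ l * (cmat Cf).mulVec V l + Yft ys τ θ l * (cmat Ct).mulVec V l

/-- The to-end branch current vector I_t = [Y_tf]C_f V + [Y_tt]C_t V. -/
def It {m n : ℕ} (Cf Ct : Matrix (Fin m) (Fin n) ℝ) (ys : Fin m → ℂ) (bc : Fin m → ℝ)
    (V : Fin n → ℂ) (τ θ : Fin m → ℝ) (l : Fin m) : ℂ :=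
  Ytf ys τ θ l * (cmat Cf).mulVec V l + Ytt ys bc l * (cmat Ct).mulVec V l

/-- ∂I_f/∂τ = [C_f V][-2Y_ff][τ]⁻¹ + [C_t V][-Y_ft][τ]⁻¹, stated entrywise:
the derivative of branch current entry `l` in the tap magnitude `τ_k`. -/
theorem If_hasDerivAt_tau {m n : ℕ}
    (Cf Ct : Matrix (Fin m) (Fin n) ℝ) (ys : Fin m → ℂ) (bc : Fin m → ℝ)
    (τ θ : Fin m → ℝ) (hτ : ∀ l, τ l ≠ 0)
    (V : Fin n → ℂ) (l k : Fin m) :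
    HasDerivAt
      (fun t : ℝ => If Cf Ct ys bc V (Function.update τ k t) θ l)
      (if l = k then
        (-1 / (τ k : ℂ)) * (2 * Yff ys bc τ k * (cmat Cf).mulVec V k
          + Yft ys τ θ k * (cmat Ct).mulVec V k)
      else 0)
      (τ k) := by
  have hk : (τ k : ℂ) ≠ 0 := Complex.ofReal_ne_zero.mpr (hτ k)
  split_ifs with h
  · subst h
    simp only [If, Yff, Yft, Function.update_self]
    have hid : HasDerivAt (fun t : ℝ => (t : ℂ)) 1 (τ l) := Complex.ofRealCLM.hasDerivAt
    have hff := ((hasDerivAt_const (τ l) (ys l + Complex.I * (bc l : ℂ) / 2)).fun_div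
      (hid.fun_pow 2) (pow_ne_zero 2 hk)).mul_const ((cmat Cf).mulVec V l)
    have hft := ((hasDerivAt_const (τ l) (-ys l * Complex.exp (Complex.I * (θ l : ℂ)))).fun_div
      hid hk).mul_const ((cmat Ct).mulVec V l)
    refine (hff.fun_add hft).congr_deriv ?_
    field_simp
    ring
  · simp only [If, Yff, Yft, Function.update_of_ne h]
    exact hasDerivAt_const _ _
end
end

section
/- Fix bus voltages V : Fin n → ℂ and branch indices l, k. Then the function t ↦ I_t(Function.update τ k t, θ)_l has derivative at τ_k equal to 0 if l ≠ k, and for l = k equal to (-1/τ_k)·Y_tf,k·(C_f·V)_k. That is, ∂I_t/∂τ = [C_f V][-Y_tf][τ]⁻¹. -/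
open Matrix

noncomputable section

/-- ∂I_t/∂τ = [C_f V][-Y_tf][τ]⁻¹, stated entrywise:
the derivative of branch current entry `l` in the tap magnitude `τ_k`. -/
theorem It_hasDerivAt_tau {m n : ℕ}
    (Cf Ct : Matrix (Fin m) (Fin n) ℝ) (ys : Fin m → ℂ) (bc : Fin m → ℝ)
    (τ θ : Fin m → ℝ) (hτ : ∀ l, τ l ≠ 0)
    (V : Fin n → ℂ) (l k : Fin m) :
    HasDerivAt
      (fun t : ℝ => It Cf Ct ys bc V (Function.update τ k t) θ l)
      (if l = k then (-1 / (τ k : ℂ)) * Ytf ys τ θ k * (cmat Cf).mulVec V k else 0)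
      (τ k) := by
  have hk : (τ k : ℂ) ≠ 0 := Complex.ofReal_ne_zero.mpr (hτ k)
  unfold It Ytf
  split_ifs with h
  · subst h
    simp only [Function.update_self]
    have hinv : HasDerivAt (fun t : ℝ => (t : ℂ)⁻¹) (-1 / (τ l : ℂ) ^ 2) (τ l) :=
      (hasDerivAt_id (τ l)).ofReal_comp.fun_inv hk
    simp only [div_eq_mul_inv (-ys l * _)]
    refine (((hinv.const_mul _).mul_const _).add_const _).congr_deriv ?_
    field_simp
  · simp only [Function.update_of_ne h]
    exact hasDerivAt_const _ _
end
end

section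
/- Fix bus voltages V : Fin n → ℂ and branch indices l, k. Then the function t ↦ I_t(τ, Function.update θ k t)_l has derivative at θ_k equal to 0 if l ≠ k, and for l = k equal to -Complex.I·Y_tf,k·(C_f·V)_k. That is, ∂I_t/∂θ = [C_f V][-jY_tf]. -/
open Matrix

noncomputable section

/-- The to-end transfer admittance of branch `k`, as a function of the phase shift angle `θ_k`,
has derivative `-i * Y_tf`. -/
theorem hasDerivAt_Ytf_update_self {m : ℕ} (ys : Fin m → ℂ) (τ θ : Fin m → ℝ) (k : Fin m) :
    HasDerivAt (fun t : ℝ => Ytf ys τ (Function.update θ k t) k)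
      (-Complex.I * Ytf ys τ θ k) (θ k) := by
  simp only [Ytf, Function.update_self]
  have hexp := (((Complex.ofRealCLM.hasDerivAt (x := θ k)).const_mul Complex.I).neg).cexp
  refine ((hexp.const_mul (-ys k)).div_const (τ k : ℂ)).congr_deriv ?_
  simp only [Pi.neg_apply, Complex.ofRealCLM_apply, Complex.ofReal_one]
  ring

/-- ∂I_t/∂θ = [C_f V][-jY_tf], stated entrywise:
the derivative of branch current entry `l` in the phase shift angle `θ_k`. -/
theorem It_hasDerivAt_theta {m n : ℕ}
    (Cf Ct : Matrix (Fin m) (Fin n) ℝ) (ys : Fin m → ℂ) (bc : Fin m → ℝ)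
    (τ θ : Fin m → ℝ) (hτ : ∀ l, τ l ≠ 0)
    (V : Fin n → ℂ) (l k : Fin m) :
    HasDerivAt
      (fun t : ℝ => It Cf Ct ys bc V τ (Function.update θ k t) l)
      (if l = k then -Complex.I * Ytf ys τ θ k * (cmat Cf).mulVec V k else 0)
      (θ k) := by
  split_ifs with h
  · subst h
    exact ((hasDerivAt_Ytf_update_self ys τ θ l).mul_const _).add_const _
  · simp only [It, Ytf, Function.update_of_ne h]
    exact hasDerivAt_const _ _
end
end

section
/- Fix bus voltages V : Fin n → ℂ, a multiplier vector λ : Fin n → ℂ, and branch indices k, l. Let g(τ,θ) = Σ_i λ_i · S_bus(τ,θ)_i. Then the second partial derivative ∂²g/∂τ_k∂τ_l equals 0 if k ≠ l, and for k = l equals (1/τ_k²)·( 6·conj(Y_ff,k)·conj((C_f·V)_k)·(C_f·(diag V)·λ)_k + 2·conj(Y_ft,k)·conj((C_t·V)_k)·(C_f·(diag V)·λ)_k + 2·conj(Y_tf,k)·conj((C_f·V)_k)·(C_t·(diag V)·λ)_k ). That is, G_ττ^s(λ) = [τ]⁻²( [6Y_ff*][C_f V*][C_f[V]λ] + [2Y_ft*][C_t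 V*][C_f[V]λ] + [2Y_tf*][C_f V*][C_t[V]λ] ). -/
open Matrix

noncomputable section

/-- Pairing `[V](Aᵀ[d]B V)*` with `λ` moves `Aᵀ` to the other side, for a real matrix `A`. -/
theorem sum_mul_conj_transpose_diagonal_mulVec {m n : ℕ}
    (A B : Matrix (Fin m) (Fin n) ℝ) (d : Fin m → ℂ) (V lam : Fin n → ℂ) :
    ∑ i, lam i * (V i *
        (starRingEnd ℂ) (((cmat A)ᵀ * diagonal d * cmat B).mulVec V i)) =
      ∑ j, (starRingEnd ℂ) (d j) * (starRingEnd ℂ) ((cmat B).mulVec V j)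
        * (cmat A * diagonal V).mulVec lam j := by
  have hmul : ∀ i, ((cmat A)ᵀ * diagonal d * cmat B).mulVec V i =
      ∑ j, (A j i : ℂ) * (d j * (cmat B).mulVec V j) := by
    intro i
    rw [← mulVec_mulVec, ← mulVec_mulVec]
    simp [mulVec, dotProduct, cmat, diagonal_apply]
  have hlam : ∀ j, (cmat A * diagonal V).mulVec lam j = ∑ i, (A j i : ℂ) * (V i * lam i) := by
    intro j
    simp [mulVec, dotProduct, cmat, mul_assoc]
  simp only [hmul, hlam, map_sum, map_mul, Complex.conj_ofReal, Finset.mul_sum]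
  rw [Finset.sum_comm]
  exact Finset.sum_congr rfl fun j _ => Finset.sum_congr rfl fun i _ => by ring

/-- The weighted sum of bus injections, written as a sum over branches. -/
theorem sum_mul_Sbus {m n : ℕ} (Cf Ct : Matrix (Fin m) (Fin n) ℝ) (ys : Fin m → ℂ)
    (bc : Fin m → ℝ) (Ysh V lam : Fin n → ℂ) (τ θ : Fin m → ℝ) :
    ∑ i, lam i * Sbus Cf Ct ys bc Ysh V τ θ i =
      ∑ j, ((starRingEnd ℂ) (Yff ys bc τ j) * (starRingEnd ℂ) ((cmat Cf).mulVec V j)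
            * (cmat Cf * diagonal V).mulVec lam j
          + (starRingEnd ℂ) (Yft ys τ θ j) * (starRingEnd ℂ) ((cmat Ct).mulVec V j)
            * (cmat Cf * diagonal V).mulVec lam j
          + (starRingEnd ℂ) (Ytf ys τ θ j) * (starRingEnd ℂ) ((cmat Cf).mulVec V j)
            * (cmat Ct * diagonal V).mulVec lam j
          + (starRingEnd ℂ) (Ytt ys bc j) * (starRingEnd ℂ) ((cmat Ct).mulVec V j)
            * (cmat Ct * diagonal V).mulVec lam j)
        + ∑ i, lam i * (V i * (starRingEnd ℂ) ((diagonal Ysh).mulVec V i)) := by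
  simp only [Sbus, Ybus, add_mulVec, Pi.add_apply, map_add, mul_add, Finset.sum_add_distrib,
    sum_mul_conj_transpose_diagonal_mulVec]

/-- The partial derivative of a separable function, in one coordinate. -/
theorem hasDerivAt_sum_update {ι E : Type*} [Fintype ι] [DecidableEq ι]
    [NormedAddCommGroup E] [NormedSpace ℝ E] (φ : ι → ℝ → E) (K φ' : E) (σ : ι → ℝ) (l : ι)
    (h : HasDerivAt (φ l) φ' (σ l)) :
    HasDerivAt (fun t => ∑ j, φ j (Function.update σ l t j) + K) φ' (σ l) := by
  have hsum : HasDerivAt (fun t => ∑ j, φ j (Function.update σ l t j))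
      (∑ j, if j = l then φ' else 0) (σ l) := by
    refine HasDerivAt.fun_sum fun j _ => ?_
    by_cases hj : j = l
    · subst hj
      simpa using h
    · simpa [hj] using hasDerivAt_const (σ l) (φ j (σ j))
  simpa using hsum.add_const K

/-- The derivative of `x ↦ a / x ^ p` for a real variable `x` and complex `a`. -/
theorem hasDerivAt_const_div_ofReal_pow (a : ℂ) (p : ℕ) {x : ℝ} (hx : x ≠ 0) :
    HasDerivAt (fun t : ℝ => a / (t : ℂ) ^ p) (-(p * a) / (x : ℂ) ^ (p + 1)) x := by
  have hx' : (x : ℂ) ≠ 0 := Complex.ofReal_ne_zero.mpr hx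
  have h := ((hasDerivAt_zpow (-(p : ℤ)) (x : ℂ) (Or.inl hx')).comp_ofReal).const_mul a
  have hexp : (-(p : ℤ) - 1) = -((p + 1 : ℕ) : ℤ) := by push_cast; ring
  rw [hexp] at h
  simp only [_root_.zpow_neg, zpow_natCast] at h
  refine h.congr_deriv ?_
  push_cast
  field_simp

/-- G_ττ^s(λ) = [τ]⁻²( [6Y_ff*][C_f V*][C_f[V]λ] + [2Y_ft*][C_t V*][C_f[V]λ]
  + [2Y_tf*][C_f V*][C_t[V]λ] ), stated entrywise: the iterated partial derivative
of g(τ,θ) = Σᵢ λᵢ·S_bus(τ,θ)ᵢ, first in τ_l, then in τ_k. -/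
theorem Sbus_lambda_hasDerivAt_tau_tau {m n : ℕ}
    (Cf Ct : Matrix (Fin m) (Fin n) ℝ) (ys : Fin m → ℂ) (bc : Fin m → ℝ)
    (Ysh : Fin n → ℂ) (τ θ : Fin m → ℝ) (hτ : ∀ l, τ l ≠ 0)
    (V : Fin n → ℂ) (lam : Fin n → ℂ) (k l : Fin m) :
    HasDerivAt
      (fun s : ℝ =>
        deriv
          (fun t : ℝ => ∑ i, lam i *
            Sbus Cf Ct ys bc Ysh V (Function.update (Function.update τ k s) l t) θ i)
          (Function.update τ k s l))
      (if k = l then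
        (1 / (τ k : ℂ) ^ 2) *
          (6 * (starRingEnd ℂ) (Yff ys bc τ k) * (starRingEnd ℂ) ((cmat Cf).mulVec V k)
              * (cmat Cf * diagonal V).mulVec lam k
            + 2 * (starRingEnd ℂ) (Yft ys τ θ k) * (starRingEnd ℂ) ((cmat Ct).mulVec V k)
              * (cmat Cf * diagonal V).mulVec lam k
            + 2 * (starRingEnd ℂ) (Ytf ys τ θ k) * (starRingEnd ℂ) ((cmat Cf).mulVec V k)
              * (cmat Ct * diagonal V).mulVec lam k)
      else 0)
      (τ k) := by
  set F : Fin m → ℂ := fun j => (starRingEnd ℂ) ((cmat Cf).mulVec V j)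
  set T : Fin m → ℂ := fun j => (starRingEnd ℂ) ((cmat Ct).mulVec V j)
  set P : Fin m → ℂ := (cmat Cf * diagonal V).mulVec lam
  set Q : Fin m → ℂ := (cmat Ct * diagonal V).mulVec lam
  let a : Fin m → ℂ := fun j =>
    (starRingEnd ℂ) (ys j + Complex.I * (bc j : ℂ) / 2) * F j * P j
  let b : Fin m → ℂ := fun j =>
    (starRingEnd ℂ) (-ys j * Complex.exp (Complex.I * (θ j : ℂ))) * T j * P j
      + (starRingEnd ℂ) (-ys j * Complex.exp (-(Complex.I * (θ j : ℂ)))) * F j * Q j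
  let c : Fin m → ℂ := fun j => (starRingEnd ℂ) (Ytt ys bc j) * T j * Q j
  let φ : Fin m → ℝ → ℂ := fun j t => a j / (t : ℂ) ^ 2 + b j / (t : ℂ) ^ 1 + c j
  let φ' : Fin m → ℝ → ℂ := fun j t => -(2 * a j) / (t : ℂ) ^ 3 + -b j / (t : ℂ) ^ 2
  have hφ : ∀ j t, t ≠ 0 → HasDerivAt (φ j) (φ' j t) t := fun j t ht => by
    simpa [φ, φ'] using ((hasDerivAt_const_div_ofReal_pow (a j) 2 ht).fun_add
      (hasDerivAt_const_div_ofReal_pow (b j) 1 ht)).add_const (c j)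
  have hsep : ∀ σ : Fin m → ℝ, ∑ i, lam i * Sbus Cf Ct ys bc Ysh V σ θ i =
      ∑ j, φ j (σ j) + ∑ i, lam i * (V i * (starRingEnd ℂ) ((diagonal Ysh).mulVec V i)) := by
    intro σ
    rw [sum_mul_Sbus]
    congr 1
    refine Finset.sum_congr rfl fun j _ => ?_
    simp only [φ, a, b, c, F, T, P, Q, Yff, Yft, Ytf, map_div₀, map_pow, Complex.conj_ofReal]
    ring
  have hderiv : ∀ σ : Fin m → ℝ, σ l ≠ 0 →
      deriv (fun t : ℝ => ∑ i, lam i *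
        Sbus Cf Ct ys bc Ysh V (Function.update σ l t) θ i) (σ l) = φ' l (σ l) := by
    intro σ hσ
    simp only [hsep]
    exact (hasDerivAt_sum_update φ _ _ σ l (hφ l _ hσ)).deriv
  by_cases hkl : k = l
  · subst hkl
    have hloc : (fun s : ℝ => deriv (fun t : ℝ => ∑ i, lam i *
          Sbus Cf Ct ys bc Ysh V (Function.update (Function.update τ k s) k t) θ i)
          (Function.update τ k s k)) =ᶠ[nhds (τ k)] φ' k := by
      filter_upwards [isOpen_ne.mem_nhds (hτ k)] with s hs
      simpa using hderiv (Function.update τ k s) (by simpa using hs)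
    have hsecond : HasDerivAt (φ' k)
        (6 * a k / (τ k : ℂ) ^ 4 + 2 * b k / (τ k : ℂ) ^ 3) (τ k) := by
      refine ((hasDerivAt_const_div_ofReal_pow (-(2 * a k)) 3 (hτ k)).fun_add
        (hasDerivAt_const_div_ofReal_pow (-b k) 2 (hτ k))).congr_deriv ?_
      push_cast
      ring
    refine (hsecond.congr_of_eventuallyEq hloc).congr_deriv ?_
    have hk : (τ k : ℂ) ≠ 0 := Complex.ofReal_ne_zero.mpr (hτ k)
    simp only [if_true, a, b, F, T, Yff, Yft, Ytf, map_div₀, map_pow, Complex.conj_ofReal]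
    field_simp
    ring
  · rw [if_neg hkl]
    have hl : ∀ s, Function.update τ k s l = τ l := fun s =>
      Function.update_of_ne (Ne.symm hkl) s τ
    have hconst : ∀ s, deriv (fun t : ℝ => ∑ i, lam i *
          Sbus Cf Ct ys bc Ysh V (Function.update (Function.update τ k s) l t) θ i)
          (Function.update τ k s l) = φ' l (τ l) := fun s => by
      rw [hderiv _ (by rw [hl]; exact hτ l), hl]
    simp only [hconst]
    exact hasDerivAt_const _ _
end
end

section
/- Fix bus voltages V : Fin n → ℂ, a multiplier vector μ : Fin m → ℂ, and branch indices k, l. Let h(τ,θ) = Σ_j μ_j · I_f(τ,θ)_j. Then the second partial derivative ∂²h/∂τ_k∂τ_l equals 0 if k ≠ l, and for k = l equals (1/τ_k²)·( 6·Y_ff,k·(C_f·V)_k·μ_k + 2·Y_ft,k·(C_t·V)_k·μ_k ). That is, I_f,ττ(μ) = 6[τ]⁻²[C_f V][μ][Y_ff] + 2[τ]⁻²[C_t V][μ][Y_ft]. -/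
open Matrix

noncomputable section

/-- The derivative of `t ↦ (t ^ k)⁻¹` along the real line, valued in `ℂ`. -/
theorem hasDerivAt_ofReal_pow_inv (k : ℕ) {x : ℝ} (hx : x ≠ 0) :
    HasDerivAt (fun t : ℝ => ((t : ℂ) ^ k)⁻¹) (-(k : ℂ) * ((x : ℂ) ^ (k + 1))⁻¹) x := by
  have hx' : (x : ℂ) ≠ 0 := Complex.ofReal_ne_zero.mpr hx
  refine ((hasDerivAt_pow k (x : ℂ)).comp_ofReal.fun_inv (pow_ne_zero k hx')).congr_deriv ?_
  cases k with
  | zero => simp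
  | succ k =>
    simp only [Nat.add_sub_cancel]
    field_simp
    ring

/-- First partial derivative of `h(τ,θ) = Σⱼ μⱼ·I_f(τ,θ)ⱼ` in the tap ratio `τ_l`. -/
theorem hasDerivAt_sum_If_update {m n : ℕ}
    (Cf Ct : Matrix (Fin m) (Fin n) ℝ) (ys : Fin m → ℂ) (bc : Fin m → ℝ)
    (σ θ : Fin m → ℝ) (V : Fin n → ℂ) (μ : Fin m → ℂ) (l : Fin m) {x : ℝ} (hx : x ≠ 0) :
    HasDerivAt (fun t : ℝ => ∑ j, μ j * If Cf Ct ys bc V (Function.update σ l t) θ j)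
      (-2 * (μ l * Ytt ys bc l * (cmat Cf).mulVec V l) * ((x : ℂ) ^ 3)⁻¹
        + μ l * ys l * Complex.exp (Complex.I * (θ l : ℂ)) * (cmat Ct).mulVec V l
          * ((x : ℂ) ^ 2)⁻¹) x := by
  have hsum : (fun t : ℝ => ∑ j, μ j * If Cf Ct ys bc V (Function.update σ l t) θ j) =
      fun t : ℝ => μ l * Ytt ys bc l * (cmat Cf).mulVec V l * ((t : ℂ) ^ 2)⁻¹
        + -(μ l * ys l * Complex.exp (Complex.I * (θ l : ℂ)) * (cmat Ct).mulVec V l)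
          * ((t : ℂ) ^ 1)⁻¹
        + ∑ j ∈ Finset.univ.erase l, μ j * If Cf Ct ys bc V σ θ j := by
    funext t
    rw [← Finset.add_sum_erase _ _ (Finset.mem_univ l)]
    congr 1
    · simp only [If, Yff, Yft, Ytt, Function.update_self]
      ring
    · refine Finset.sum_congr rfl fun j hj => ?_
      simp only [If, Yff, Yft, Function.update_of_ne (Finset.ne_of_mem_erase hj)]
  rw [hsum]
  refine ((((hasDerivAt_ofReal_pow_inv 2 hx).const_mul _).add
    ((hasDerivAt_ofReal_pow_inv 1 hx).const_mul _)).add_const _).congr_deriv ?_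
  push_cast
  ring

/-- I_f,ττ(μ) = 6[τ]⁻²[C_f V][μ][Y_ff] + 2[τ]⁻²[C_t V][μ][Y_ft], stated entrywise:
the iterated partial derivative of h(τ,θ) = Σⱼ μⱼ·I_f(τ,θ)ⱼ, first in τ_l, then in τ_k. -/
theorem If_mu_hasDerivAt_tau_tau {m n : ℕ}
    (Cf Ct : Matrix (Fin m) (Fin n) ℝ) (ys : Fin m → ℂ) (bc : Fin m → ℝ)
    (τ θ : Fin m → ℝ) (hτ : ∀ l, τ l ≠ 0)
    (V : Fin n → ℂ) (μ : Fin m → ℂ) (k l : Fin m) :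
    HasDerivAt
      (fun s : ℝ =>
        deriv
          (fun t : ℝ => ∑ j, μ j *
            If Cf Ct ys bc V (Function.update (Function.update τ k s) l t) θ j)
          (Function.update τ k s l))
      (if k = l then
        (1 / (τ k : ℂ) ^ 2) *
          (6 * Yff ys bc τ k * (cmat Cf).mulVec V k * μ k
            + 2 * Yft ys τ θ k * (cmat Ct).mulVec V k * μ k)
      else 0)
      (τ k) := by
  by_cases hkl : k = l
  · subst hkl
    have hx' : (τ k : ℂ) ≠ 0 := Complex.ofReal_ne_zero.mpr (hτ k)
    have hder := ((hasDerivAt_ofReal_pow_inv 3 (hτ k)).const_mul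
        (-2 * (μ k * Ytt ys bc k * (cmat Cf).mulVec V k))).add
      ((hasDerivAt_ofReal_pow_inv 2 (hτ k)).const_mul
        (μ k * ys k * Complex.exp (Complex.I * (θ k : ℂ)) * (cmat Ct).mulVec V k))
    refine (hder.congr_of_eventuallyEq ?_).congr_deriv ?_
    · filter_upwards [isOpen_ne.mem_nhds (hτ k)] with s hs
      rw [Function.update_self]
      exact (hasDerivAt_sum_If_update Cf Ct ys bc (Function.update τ k s) θ V μ k hs).deriv
    · rw [if_pos rfl]
      simp only [Yff, Yft, Ytt]
      push_cast
      field_simp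
      ring
  · rw [if_neg hkl]
    refine (hasDerivAt_const (τ k)
      (-2 * (μ l * Ytt ys bc l * (cmat Cf).mulVec V l) * ((τ l : ℂ) ^ 3)⁻¹
        + μ l * ys l * Complex.exp (Complex.I * (θ l : ℂ)) * (cmat Ct).mulVec V l
          * ((τ l : ℂ) ^ 2)⁻¹)).congr_of_eventuallyEq (Filter.Eventually.of_forall fun s => ?_)
    simp only [Function.update_of_ne (Ne.symm hkl)]
    exact (hasDerivAt_sum_If_update Cf Ct ys bc (Function.update τ k s) θ V μ l (hτ l)).deriv
end
end

section
/- Fix bus voltages V : Fin n → ℂ, a multiplier vector μ : Fin m → ℂ, and branch indices k, l. Let h(τ,θ) = Σ_j μ_j · I_f(τ,θ)_j. Then the mixed second partial derivative ∂²h/∂θ_k∂τ_l (first differentiate in τ_l, then in θ_k) equals 0 if k ≠ l, and for k = l equals −(1/τ_k)·Complex.I·Y_ft,k·(C_t·V)_k·μ_k. That is, I_f,τθ(μ) = −[τ]⁻¹[C_t V][μ][jY_ft]. -/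
open Matrix

noncomputable section

/-- The partial derivative of a single from-end current in the tap ratio of branch `l`. -/
theorem hasDerivAt_If_tau {m n : ℕ}
    (Cf Ct : Matrix (Fin m) (Fin n) ℝ) (ys : Fin m → ℂ) (bc : Fin m → ℝ)
    (τ θ : Fin m → ℝ) (V : Fin n → ℂ) (l j : Fin m) (hl : τ l ≠ 0) :
    HasDerivAt (fun t : ℝ => If Cf Ct ys bc V (Function.update τ l t) θ j)
      (if j = l then
        -(2 / (τ l : ℂ) * Yff ys bc τ l * (cmat Cf).mulVec V l
          + 1 / (τ l : ℂ) * Yft ys τ θ l * (cmat Ct).mulVec V l)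
      else 0) (τ l) := by
  by_cases h : j = l
  · subst h
    have hc : (τ j : ℂ) ≠ 0 := Complex.ofReal_ne_zero.mpr hl
    have hid : HasDerivAt (fun t : ℝ => (t : ℂ)) 1 (τ j) := Complex.ofRealCLM.hasDerivAt
    simp only [If, Yff, Yft, Function.update_self, if_true]
    have hff := ((hasDerivAt_const (τ j) (ys j + Complex.I * (bc j : ℂ) / 2)).fun_div
      (hid.fun_pow 2) (pow_ne_zero 2 hc)).mul_const ((cmat Cf).mulVec V j)
    have hft := ((hasDerivAt_const (τ j) (-ys j * Complex.exp (Complex.I * (θ j : ℂ)))).fun_div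
      hid hc).mul_const ((cmat Ct).mulVec V j)
    refine (hff.fun_add hft).congr_deriv ?_
    field_simp
    ring
  · simp only [If, Yff, Yft, Function.update_of_ne h, if_neg h]
    exact hasDerivAt_const _ _

/-- The partial derivative of `∑ⱼ μⱼ I_f,ⱼ` in the tap ratio of branch `l`. -/
theorem hasDerivAt_sum_If_tau {m n : ℕ}
    (Cf Ct : Matrix (Fin m) (Fin n) ℝ) (ys : Fin m → ℂ) (bc : Fin m → ℝ)
    (τ θ : Fin m → ℝ) (V : Fin n → ℂ) (μ : Fin m → ℂ) (l : Fin m) (hl : τ l ≠ 0) :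
    HasDerivAt (fun t : ℝ => ∑ j, μ j * If Cf Ct ys bc V (Function.update τ l t) θ j)
      (μ l * -(2 / (τ l : ℂ) * Yff ys bc τ l * (cmat Cf).mulVec V l
        + 1 / (τ l : ℂ) * Yft ys τ θ l * (cmat Ct).mulVec V l)) (τ l) := by
  refine (HasDerivAt.fun_sum fun j _ =>
    (hasDerivAt_If_tau Cf Ct ys bc τ θ V l j hl).const_mul (μ j)).congr_deriv ?_
  simp

/-- The partial derivative of `Y_ft,l` in the phase shift of branch `k`. -/
theorem hasDerivAt_Yft_theta {m : ℕ} (ys : Fin m → ℂ) (τ θ : Fin m → ℝ) (k l : Fin m) :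
    HasDerivAt (fun s : ℝ => Yft ys τ (Function.update θ k s) l)
      (if k = l then Complex.I * Yft ys τ θ l else 0) (θ k) := by
  by_cases h : k = l
  · subst h
    have hid : HasDerivAt (fun s : ℝ => (s : ℂ)) 1 (θ k) := Complex.ofRealCLM.hasDerivAt
    simp only [Yft, Function.update_self, if_true]
    refine (((hid.const_mul Complex.I).cexp.const_mul (-ys k)).div_const
      (τ k : ℂ)).congr_deriv ?_
    ring
  · simp only [Yft, Function.update_of_ne (Ne.symm h), if_neg h]
    exact hasDerivAt_const _ _

/-- I_f,τθ(μ) = −[τ]⁻¹[C_t V][μ][jY_ft], stated entrywise: the iterated partial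
derivative of h(τ,θ) = Σⱼ μⱼ·I_f(τ,θ)ⱼ, first in τ_l, then in θ_k. -/
theorem If_mu_hasDerivAt_theta_tau {m n : ℕ}
    (Cf Ct : Matrix (Fin m) (Fin n) ℝ) (ys : Fin m → ℂ) (bc : Fin m → ℝ)
    (τ θ : Fin m → ℝ) (hτ : ∀ l, τ l ≠ 0)
    (V : Fin n → ℂ) (μ : Fin m → ℂ) (k l : Fin m) :
    HasDerivAt
      (fun s : ℝ =>
        deriv
          (fun t : ℝ => ∑ j, μ j *
            If Cf Ct ys bc V (Function.update τ l t) (Function.update θ k s) j)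
          (τ l))
      (if k = l then
        -((1 / (τ k : ℂ)) * Complex.I * Yft ys τ θ k * (cmat Ct).mulVec V k * μ k)
      else 0)
      (θ k) := by
  simp only [fun s : ℝ =>
    (hasDerivAt_sum_If_tau Cf Ct ys bc τ (Function.update θ k s) V μ l (hτ l)).deriv]
  refine (((((hasDerivAt_Yft_theta ys τ θ k l).const_mul (1 / (τ l : ℂ))).mul_const
    ((cmat Ct).mulVec V l)).const_add
    (2 / (τ l : ℂ) * Yff ys bc τ l * (cmat Cf).mulVec V l)).fun_neg.const_mul
    (μ l)).congr_deriv ?_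
  split_ifs with h
  · subst h
    ring
  · simp
end
end

section
/- Fix bus voltages V : Fin n → ℂ, a multiplier vector μ : Fin m → ℂ, and branch indices k, l. Let h(τ,θ) = Σ_j μ_j · I_f(τ,θ)_j. Then the second partial derivative ∂²h/∂θ_k∂θ_l equals 0 if k ≠ l, and for k = l equals −Y_ft,k·(C_t·V)_k·μ_k. That is, I_f,θθ(μ) = [C_t V][μ][−Y_ft]. -/
open Matrix

noncomputable section

theorem Yft_update_of_ne {m : ℕ} (ys : Fin m → ℂ) (τ φ : Fin m → ℝ) {j l : Fin m}
    (h : j ≠ l) (t : ℝ) : Yft ys τ (Function.update φ l t) j = Yft ys τ φ j := by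
  simp [Yft, Function.update_of_ne h]

theorem hasDerivAt_Yft_update {m : ℕ} (ys : Fin m → ℂ) (τ φ : Fin m → ℝ) (j l : Fin m) (t : ℝ) :
    HasDerivAt (fun t : ℝ => Yft ys τ (Function.update φ l t) j)
      (if j = l then Complex.I * Yft ys τ (Function.update φ l t) j else 0) t := by
  split_ifs with h
  · subst h
    simp only [Yft, Function.update_self]
    have h1 : HasDerivAt (fun t : ℝ => Complex.I * (t : ℂ)) (Complex.I * 1) t :=
      (Complex.ofRealCLM.hasDerivAt (x := t)).const_mul Complex.I
    refine ((h1.cexp.const_mul (-ys j)).div_const (τ j : ℂ)).congr_deriv ?_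
    ring
  · simp only [Yft_update_of_ne ys τ φ h]
    exact hasDerivAt_const t _

/-- The partial derivative of `∑ j, μ j * I_f j` in the phase shift `θ_l`. -/
theorem hasDerivAt_sum_mul_If_update {m n : ℕ} (Cf Ct : Matrix (Fin m) (Fin n) ℝ)
    (ys : Fin m → ℂ) (bc : Fin m → ℝ) (V : Fin n → ℂ) (τ φ : Fin m → ℝ) (μ : Fin m → ℂ)
    (l : Fin m) (t : ℝ) :
    HasDerivAt (fun t : ℝ => ∑ j, μ j * If Cf Ct ys bc V τ (Function.update φ l t) j)
      (μ l * (Complex.I * Yft ys τ (Function.update φ l t) l * (cmat Ct).mulVec V l)) t := by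
  have h := HasDerivAt.fun_sum (u := Finset.univ) fun j _ =>
    (((hasDerivAt_Yft_update ys τ φ j l t).mul_const ((cmat Ct).mulVec V j)).const_add
      (Yff ys bc τ j * (cmat Cf).mulVec V j)).const_mul (μ j)
  simpa [If, ite_mul, mul_ite] using h

/-- I_f,θθ(μ) = [C_t V][μ][−Y_ft], stated entrywise: the iterated partial derivative
of h(τ,θ) = Σⱼ μⱼ·I_f(τ,θ)ⱼ, first in θ_l, then in θ_k. -/
theorem If_mu_hasDerivAt_theta_theta {m n : ℕ}
    (Cf Ct : Matrix (Fin m) (Fin n) ℝ) (ys : Fin m → ℂ) (bc : Fin m → ℝ)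
    (τ θ : Fin m → ℝ) (hτ : ∀ l, τ l ≠ 0)
    (V : Fin n → ℂ) (μ : Fin m → ℂ) (k l : Fin m) :
    HasDerivAt
      (fun s : ℝ =>
        deriv
          (fun t : ℝ => ∑ j, μ j *
            If Cf Ct ys bc V τ (Function.update (Function.update θ k s) l t) j)
          (Function.update θ k s l))
      (if k = l then -(Yft ys τ θ k * (cmat Ct).mulVec V k * μ k) else 0)
      (θ k) := by
  have hd (s : ℝ) := (hasDerivAt_sum_mul_If_update Cf Ct ys bc V τ (Function.update θ k s) μ l
    (Function.update θ k s l)).deriv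
  simp only [hd, Function.update_eq_self]
  refine ((((hasDerivAt_Yft_update ys τ θ l k (θ k)).const_mul Complex.I).mul_const
    ((cmat Ct).mulVec V l)).const_mul (μ l)).congr_deriv ?_
  by_cases h : k = l
  · subst h
    simp only [if_true, Function.update_eq_self]
    linear_combination (Yft ys τ θ k * (cmat Ct).mulVec V k * μ k) * Complex.I_mul_I
  · simp [h, Ne.symm h]
end
end
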